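/- Let α ≥ 0, β > 0 and f(k) = k/2 + (α/2)·k/log(k ∨ e) + β. For every k ∈ ℕ there exist n₀ ∈ ℕ and a constant C(k) > 0 such that for all n₀ ≤ m ≤ N, and all disjoint sets I₀, I₁ ⊂ {m,…,N−1} with #I₁ ≤ k−1 and ξ(m,N)·∑_{l∈I₀} ξ(l,N) ≤ C(k)·N/(2·ψ^k(n₀,N)), the following holds for every degree evolution (Z[m,n])_{n≥m} with attachment rule f started at 0: writing A_i = {ΔZ[m,l] = 1 for all l ∈ I₁} ∩ {ΔZ[m,l] = 0 for all l ∈ I₀} decomposed as A₁ = {ΔZ[m,l] = 1 ∀ l ∈ I₁} and A₀ = {ΔZ[m,l] = 0 ∀ l ∈ I₀}, and assuming ℙ(A₀ ∩ A₁) > 0, one has ℙ(ΔZ[m,j] = 1 | A₀ ∩ A₁) ≥ (1/2)·ℙ(ΔZ[m,j] = 1 | A₁) for all j ∈ {m,…,N−1} \ I₀. -/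

import Mathlib

open MeasureTheory

/-- The attachment rule `f(k) = k/2 + (α/2)·k/log(k ∨ e) + β`. -/
noncomputable def fPA (α β : ℝ) (k : ℕ) : ℝ :=
  (k : ℝ) / 2 + α / 2 * (k : ℝ) / Real.log (max (k : ℝ) (Real.exp 1)) + β

/-- `ξ(m,n) = ∏_{i=m}^{n-1} (1 + 1/(2i))`. -/
noncomputable def xi (m n : ℕ) : ℝ := ∏ i ∈ Finset.Ico m n, (1 + 1 / (2 * (i : ℝ)))

/-- A degree evolution with attachment rule `f`, started at time `m` in state `k`:
a Markov chain on `ℕ` with increments in `{0,1}` and conditional jump probability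
`f(Z[m,n])/n` given the past. -/
structure DegreeEvolution {Ω : Type} [MeasurableSpace Ω] (μ : Measure Ω)
    (f : ℕ → ℝ) (m k : ℕ) (Z : ℕ → Ω → ℕ) : Prop where
  measurable : ∀ n, Measurable (Z n)
  init : ∀ ω, Z m ω = k
  incr : ∀ n, m ≤ n → ∀ ω, Z (n + 1) ω = Z n ω ∨ Z (n + 1) ω = Z n ω + 1
  jump : ∀ n, m ≤ n → ∀ h : ℕ → ℕ,
    μ ({ω | Z (n + 1) ω = Z n ω + 1} ∩ {ω | ∀ i, m ≤ i → i ≤ n → Z i ω = h i})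
      = ENNReal.ofReal (f (h n) / (n : ℝ)) * μ {ω | ∀ i, m ≤ i → i ≤ n → Z i ω = h i}

/-- The expectation of `g (Z (n + d))` on the event that `Z` jumps at all times of `I ∩ [n, n + d)`,
for the chain with attachment rule `f` started in state `z` at time `n`. -/
noncomputable def jumpExp (f : ℕ → ℝ) (I : Finset ℕ) (g : ℕ → ℝ) : ℕ → ℕ → ℕ → ℝ
  | 0, _, z => g z
  | d + 1, n, z =>
      if n ∈ I then f z / n * jumpExp f I g d (n + 1) (z + 1)
      else (1 - f z / n) * jumpExp f I g d (n + 1) z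
        + f z / n * jumpExp f I g d (n + 1) (z + 1)

section AttachmentRule

variable {α β : ℝ}

lemma one_le_log_max_exp (x : ℝ) : 1 ≤ Real.log (max x (Real.exp 1)) := by
  rw [Real.le_log_iff_exp_le (lt_max_of_lt_right (Real.exp_pos 1))]
  exact le_max_right _ _

lemma log_max_exp_mono {x y : ℝ} (h : x ≤ y) :
    Real.log (max x (Real.exp 1)) ≤ Real.log (max y (Real.exp 1)) :=
  Real.log_le_log (lt_max_of_lt_right (Real.exp_pos 1)) (max_le_max_right _ h)

lemma div_log_max_exp_mono {x y : ℝ} (h : x ≤ y) :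
    x / Real.log (max x (Real.exp 1)) ≤ y / Real.log (max y (Real.exp 1)) := by
  have hX := one_le_log_max_exp x
  rcases le_total y (Real.exp 1) with hy | hy
  · rw [max_eq_right hy, max_eq_right (h.trans hy), Real.log_exp]
    simpa using h
  have key : ∀ {a b : ℝ}, Real.exp 1 ≤ a → a ≤ b → a / Real.log a ≤ b / Real.log b := by
    intro a b ha hab
    have ha0 := (Real.exp_pos 1).trans_le ha
    have hb0 := ha0.trans_le hab
    have hla : 1 ≤ Real.log a := by rwa [Real.le_log_iff_exp_le ha0]
    have hlb : 1 ≤ Real.log b := by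
      rw [Real.le_log_iff_exp_le hb0]; exact ha.trans hab
    have := Real.log_div_self_antitoneOn (Set.mem_ofPred.2 ha) (Set.mem_ofPred.2 (ha.trans hab)) hab
    rw [div_le_div_iff₀ hb0 ha0] at this
    rw [div_le_div_iff₀ (by linarith) (by linarith)]
    linarith
  rcases le_total x (Real.exp 1) with hxe | hxe
  · rw [max_eq_right hxe, max_eq_left hy]
    have := key le_rfl hy
    refine le_trans ?_ this
    gcongr
    simp
  · rw [max_eq_left hxe, max_eq_left hy]
    exact key hxe h

lemma fPA_pos (hα : 0 ≤ α) (hβ : 0 < β) (z : ℕ) : 0 < fPA α β z := by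
  have := one_le_log_max_exp (z : ℝ)
  unfold fPA
  positivity

lemma fPA_succ (hα : 0 ≤ α) (z : ℕ) : fPA α β z + 1 / 2 ≤ fPA α β (z + 1) := by
  have h := div_log_max_exp_mono (x := (z : ℝ)) (y := ((z + 1 : ℕ) : ℝ))
    (by push_cast; linarith)
  have h2 := mul_le_mul_of_nonneg_left h (by positivity : 0 ≤ α / 2)
  rw [← mul_div_assoc, ← mul_div_assoc] at h2
  unfold fPA
  push_cast at h2 ⊢
  linarith

lemma fPA_succ_mul_le (hα : 0 ≤ α) {c : ℝ} (hc : 0 < c) (hcβ : (1 + α) / 2 * c = β) (z : ℕ) :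
    fPA α β (z + 1) * (z + c) ≤ fPA α β z * (z + 1 + c) := by
  have hz : (0 : ℝ) ≤ z := by positivity
  have e : ∀ w : ℕ, fPA α β w
      = (1 / 2 + α / 2 * (Real.log (max (w : ℝ) (Real.exp 1)))⁻¹) * w + β := by
    intro w; unfold fPA; ring
  rw [e, e]
  set L := (Real.log (max (z : ℝ) (Real.exp 1)))⁻¹ with hL
  set L' := (Real.log (max ((z + 1 : ℕ) : ℝ) (Real.exp 1)))⁻¹ with hL'
  have hLL : L' ≤ L := inv_anti₀ (by linarith [one_le_log_max_exp (z : ℝ)])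
    (log_max_exp_mono (by push_cast; linarith))
  have hL1 : L ≤ 1 := inv_le_one_of_one_le₀ (one_le_log_max_exp _)
  have h1 : 0 ≤ α * (L - L') * ((z + 1) * (z + c)) := by
    have := sub_nonneg.2 hLL
    positivity
  have h2 : 0 ≤ α * (1 - L) * c := by
    have := sub_nonneg.2 hL1
    positivity
  push_cast
  subst hcβ
  nlinarith

lemma exists_fPA_le_add (hα : 0 ≤ α) :
    ∃ s : ℕ, ∀ z : ℕ, fPA α β z ≤ z + s := by
  obtain ⟨s, hs⟩ := exists_nat_ge (β + α / 2 * Real.exp α)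
  refine ⟨s, fun z => ?_⟩
  have hz : (0 : ℝ) ≤ z := by positivity
  have hL := one_le_log_max_exp (z : ℝ)
  suffices α / 2 * z / Real.log (max (z : ℝ) (Real.exp 1)) ≤ z / 2 + α / 2 * Real.exp α by
    unfold fPA; linarith
  rcases le_total α (Real.log (max (z : ℝ) (Real.exp 1))) with h | h
  · rw [div_le_iff₀ (by linarith)]
    have : 0 ≤ α / 2 * Real.exp α * Real.log (max (z : ℝ) (Real.exp 1)) := by positivity
    nlinarith
  · have hze : (z : ℝ) ≤ Real.exp α := by
      rw [Real.log_le_iff_le_exp (lt_max_of_lt_right (Real.exp_pos 1))] at h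
      exact (le_max_left _ _).trans h
    have h1 : α / 2 * z / Real.log (max (z : ℝ) (Real.exp 1)) ≤ α / 2 * z :=
      div_le_self (by positivity) hL
    have h2 : α / 2 * z ≤ α / 2 * Real.exp α := by gcongr
    linarith

end AttachmentRule

section Xi

lemma xi_pos (m n : ℕ) : 0 < xi m n := Finset.prod_pos fun _ _ => by positivity

lemma xi_mul_xi {l m n : ℕ} (hlm : l ≤ m) (hmn : m ≤ n) : xi l m * xi m n = xi l n :=
  Finset.prod_Ico_consecutive _ hlm hmn

lemma xi_eq_mul {m n : ℕ} (h : m < n) : xi m n = (1 + 1 / (2 * (m : ℝ))) * xi (m + 1) n :=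
  Finset.prod_eq_prod_Ico_succ_bot h _

lemma natCast_le_mul_xi_sq {l N : ℕ} (hl : 1 ≤ l) (h : l ≤ N) : (N : ℝ) ≤ l * xi l N ^ 2 := by
  induction N, h using Nat.le_induction with
  | base => simp [xi]
  | succ N hN ih =>
    have hN0 : (0 : ℝ) < N := by exact_mod_cast (by omega : 0 < N)
    have e : xi l (N + 1) = xi l N * (1 + 1 / (2 * (N : ℝ))) := Finset.prod_Ico_succ_top hN _
    have h1 : (N : ℝ) + 1 ≤ N * (1 + 1 / (2 * (N : ℝ))) ^ 2 := by
      field_simp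
      nlinarith
    calc ((N + 1 : ℕ) : ℝ) ≤ N * (1 + 1 / (2 * (N : ℝ))) ^ 2 := by exact_mod_cast h1
      _ ≤ (l * xi l N ^ 2) * (1 + 1 / (2 * (N : ℝ))) ^ 2 := by gcongr
      _ = _ := by rw [e]; ring

end Xi

section JumpExp

variable {f g : ℕ → ℝ} {I : Finset ℕ} {s : ℕ}

lemma div_natCast_le_one (hs : ∀ z, f z ≤ z + s) {n z : ℕ} (h : z + s ≤ n) :
    f z / n ≤ 1 := by
  refine div_le_one_of_le₀ ((hs z).trans ?_) (by positivity)
  exact_mod_cast h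

lemma jumpExp_congr {I' : Finset ℕ} (d : ℕ) : ∀ n z, (∀ i, n ≤ i → (i ∈ I ↔ i ∈ I')) →
    jumpExp f I g d n z = jumpExp f I' g d n z := by
  induction d with
  | zero => intro n z _; rfl
  | succ d ih =>
    intro n z h
    have ih' := fun w => ih (n + 1) w fun i hi => h i (by omega)
    simp only [jumpExp, ih', h n le_rfl]

lemma jumpExp_nonneg (hf : ∀ z, 0 < f z) (hs : ∀ z, f z ≤ z + s) (hg : ∀ z, 0 ≤ g z) (d : ℕ) :
    ∀ n z, z + s ≤ n → 0 ≤ jumpExp f I g d n z := by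
  induction d with
  | zero => intro n z _; exact hg z
  | succ d ih =>
    intro n z h
    have h0 := ih (n + 1) z (by omega)
    have h1 := ih (n + 1) (z + 1) (by omega)
    have hp : 0 ≤ f z / n := div_nonneg (hf z).le (by positivity)
    have hq := sub_nonneg.2 (div_natCast_le_one hs h)
    simp only [jumpExp]
    split_ifs <;> positivity

lemma jumpExp_mono (hf : ∀ z, 0 < f z) (hfm : ∀ z, f z ≤ f (z + 1)) (hs : ∀ z, f z ≤ z + s)
    (hg : ∀ z, 0 ≤ g z) (hgm : ∀ z, g z ≤ g (z + 1)) (d : ℕ) :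
    ∀ n z, z + 1 + s ≤ n → jumpExp f I g d n z ≤ jumpExp f I g d n (z + 1) := by
  induction d with
  | zero => intro n z _; exact hgm z
  | succ d ih =>
    intro n z h
    have h0 := ih (n + 1) z (by omega)
    have h1 := ih (n + 1) (z + 1) (by omega)
    have h1' := jumpExp_nonneg (I := I) hf hs hg d (n + 1) (z + 1) (by omega)
    have hp : 0 ≤ f z / n := div_nonneg (hf z).le (by positivity)
    have hp' : f z / n ≤ f (z + 1) / n := by gcongr; exact hfm z
    have hq := sub_nonneg.2 (div_natCast_le_one hs (by omega : z + s ≤ n))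
    simp only [jumpExp]
    split_ifs
    · gcongr
      exact hp.trans hp'
    · nlinarith [mul_le_mul_of_nonneg_left h0 hq,
        mul_le_mul_of_nonneg_left h1 (hp.trans hp')]

lemma le_jumpExp_of_notMem (hf : ∀ z, 0 < f z) (hfm : ∀ z, f z ≤ f (z + 1))
    (hs : ∀ z, f z ≤ z + s) (hg : ∀ z, 0 ≤ g z) (hgm : ∀ z, g z ≤ g (z + 1)) {d n z : ℕ}
    (hn : n ∉ I) (h : z + s ≤ n) :
    jumpExp f I g d (n + 1) z ≤ jumpExp f I g (d + 1) n z := by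
  have h0 := jumpExp_mono (I := I) hf hfm hs hg hgm d (n + 1) z (by omega)
  have hp : 0 ≤ f z / n := div_nonneg (hf z).le (by positivity)
  simp only [jumpExp, if_neg hn]
  nlinarith [mul_le_mul_of_nonneg_left h0 hp]

/-- The number of constrained jumps in `[n, n + d + 1)` splits at `n`. -/
lemma card_filter_Ico_succ {n d : ℕ} :
    (I.filter fun i => n ≤ i ∧ i < n + (d + 1)).card
      = (I.filter fun i => n + 1 ≤ i ∧ i < n + 1 + d).card + if n ∈ I then 1 else 0 := by
  split_ifs with hn
  · have : I.filter (fun i => n ≤ i ∧ i < n + (d + 1))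
        = insert n (I.filter fun i => n + 1 ≤ i ∧ i < n + 1 + d) := by
      ext i
      simp only [Finset.mem_filter, Finset.mem_insert]
      constructor
      · rintro ⟨h1, h2, h3⟩
        rcases eq_or_lt_of_le h2 with h | h
        · exact Or.inl h.symm
        · exact Or.inr ⟨h1, by omega, by omega⟩
      · rintro (rfl | ⟨h1, h2, h3⟩)
        · exact ⟨hn, le_rfl, by omega⟩
        · exact ⟨h1, by omega, by omega⟩
    rw [this, Finset.card_insert_of_notMem (by simp)]
  · rw [add_zero]
    congr 1
    ext i
    simp only [Finset.mem_filter, and_congr_right_iff]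
    intro hi
    have : i ≠ n := by rintro rfl; exact hn hi
    omega

lemma mul_pow_sub_one_succ_le {ρ : ℕ → ℝ} (hf : ∀ z, 0 < f z) (hρ : ∀ z, 1 ≤ ρ z)
    (hρm : ∀ z, ρ (z + 1) ≤ ρ z) (ha : ∀ z, f (z + 1) * (ρ (z + 1) - 1) ≤ f z * (ρ z - 1))
    (r z : ℕ) : f (z + 1) * (ρ (z + 1) ^ r - 1) ≤ f z * (ρ z ^ r - 1) := by
  induction r with
  | zero => simp
  | succ r ih =>
    have h0 : 0 ≤ f z * (ρ z ^ r - 1) :=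
      mul_nonneg (hf z).le (sub_nonneg.2 (one_le_pow₀ (hρ z)))
    have h1 : ρ (z + 1) * (f (z + 1) * (ρ (z + 1) ^ r - 1)) ≤ ρ z * (f z * (ρ z ^ r - 1)) :=
      (mul_le_mul_of_nonneg_left ih (by linarith [hρ (z + 1)])).trans
        (mul_le_mul_of_nonneg_right (hρm z) h0)
    have := ha z
    rw [pow_succ, pow_succ]
    linarith

/-- Starting from a state that is larger by one increases the expectation by a factor that is
controlled by the number of constrained jumps. -/
lemma jumpExp_succ_le {ρ : ℕ → ℝ} (hf : ∀ z, 0 < f z) (hs : ∀ z, f z ≤ z + s)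
    (hg : ∀ z, 0 ≤ g z) (hρ : ∀ z, 1 ≤ ρ z)
    (hρm : ∀ z, ρ (z + 1) ≤ ρ z) (ha : ∀ z, f (z + 1) * (ρ (z + 1) - 1) ≤ f z * (ρ z - 1))
    (hfρ : ∀ z, f (z + 1) ≤ ρ z * f z) {t : ℕ} (hgρ : ∀ z, g (z + 1) ≤ ρ z ^ t * g z) (d : ℕ) :
    ∀ n z r, z + 1 + s ≤ n → (I.filter fun i => n ≤ i ∧ i < n + d).card + t ≤ r →
      jumpExp f I g d n (z + 1) ≤ ρ z ^ r * jumpExp f I g d n z := by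
  induction d with
  | zero =>
    intro n z r _ hr
    refine (hgρ z).trans (mul_le_mul_of_nonneg_right ?_ (hg z))
    exact pow_le_pow_right₀ (hρ z) (by omega)
  | succ d ih =>
    intro n z r h hr
    rw [card_filter_Ico_succ] at hr
    have n0 := jumpExp_nonneg (I := I) hf hs hg d (n + 1) z (by omega)
    have n1 := jumpExp_nonneg (I := I) hf hs hg d (n + 1) (z + 1) (by omega)
    have n2 := jumpExp_nonneg (I := I) hf hs hg d (n + 1) (z + 1 + 1) (by omega)
    have hp : 0 ≤ f z / n := div_nonneg (hf z).le (by positivity)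
    have hp' : 0 ≤ f (z + 1) / n := div_nonneg (hf (z + 1)).le (by positivity)
    have hq := sub_nonneg.2 (div_natCast_le_one hs (by omega : z + s ≤ n))
    have hρ0 : 0 ≤ ρ z := by linarith [hρ z]
    have hρ1 : 0 ≤ ρ (z + 1) := by linarith [hρ (z + 1)]
    simp only [jumpExp]
    split_ifs with hn
    · rw [if_pos hn] at hr
      obtain ⟨r, rfl⟩ : ∃ r', r = r' + 1 := ⟨r - 1, by omega⟩
      have i1 := ih (n + 1) (z + 1) r (by omega) (by omega)
      have hf1 : f (z + 1) / n ≤ ρ z * (f z / n) := by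
        rw [← mul_div_assoc]; gcongr; exact hfρ z
      calc f (z + 1) / n * jumpExp f I g d (n + 1) (z + 1 + 1)
          ≤ (ρ z * (f z / n)) * (ρ z ^ r * jumpExp f I g d (n + 1) (z + 1)) := by
            refine mul_le_mul hf1 (i1.trans ?_) n2 (by positivity)
            gcongr
            exact hρm z
        _ = _ := by ring
    · rw [if_neg hn] at hr
      have i0 := ih (n + 1) z r (by omega) (by omega)
      have i1 := ih (n + 1) (z + 1) r (by omega) (by omega)
      have hR := mul_pow_sub_one_succ_le hf hρ hρm ha r z
      have hR' : f (z + 1) / n * (ρ (z + 1) ^ r - 1) ≤ f z / n * (ρ z ^ r - 1) := by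
        rw [div_mul_eq_mul_div, div_mul_eq_mul_div]; gcongr
      have a1 := mul_le_mul_of_nonneg_left i1 hp'
      have a2 := mul_le_mul_of_nonneg_right hR' n1
      have a3 := mul_le_mul_of_nonneg_left i0 hq
      nlinarith

/-- Applying the generator to an unconstrained expectation. -/
lemma half_jumpExp_le (hf : ∀ z, 0 < f z) (hfm : ∀ z, f z + 1 / 2 ≤ f (z + 1))
    (hs : ∀ z, f z ≤ z + s) (d : ℕ) : ∀ n z, z + 1 + s ≤ n →
      jumpExp f ∅ f d n z / 2 ≤ f z * (jumpExp f ∅ f d n (z + 1) - jumpExp f ∅ f d n z) := by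
  induction d with
  | zero =>
    intro n z _
    simp only [jumpExp]
    nlinarith [hfm z, hf z]
  | succ d ih =>
    intro n z h
    have i0 := ih (n + 1) z (by omega)
    have i1 := ih (n + 1) (z + 1) (by omega)
    have hp : 0 ≤ f z / n := div_nonneg (hf z).le (by positivity)
    have hq := sub_nonneg.2 (div_natCast_le_one hs (by omega : z + s ≤ n))
    simp only [jumpExp, Finset.notMem_empty, if_false]
    set v0 := jumpExp f ∅ f d (n + 1) z
    set v1 := jumpExp f ∅ f d (n + 1) (z + 1)
    set v2 := jumpExp f ∅ f d (n + 1) (z + 1 + 1)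
    have e : f z * ((1 - f (z + 1) / n) * v1 + f (z + 1) / n * v2
        - ((1 - f z / n) * v0 + f z / n * v1))
        = (1 - f z / n) * (f z * (v1 - v0)) + f z / n * (f (z + 1) * (v2 - v1)) := by ring
    rw [e]
    linarith [mul_le_mul_of_nonneg_left i0 hq, mul_le_mul_of_nonneg_left i1 hp]

lemma xi_mul_jumpExp_le (hf : ∀ z, 0 < f z) (hfm : ∀ z, f z + 1 / 2 ≤ f (z + 1))
    (hs : ∀ z, f z ≤ z + s) (d e : ℕ) : ∀ n z, z + s ≤ n →
      xi n (n + e) * jumpExp f ∅ f d (n + e) z ≤ jumpExp f ∅ f (e + d) n z := by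
  induction e with
  | zero => intro n z _; simp [xi]
  | succ e ih =>
    intro n z h
    have i := ih (n + 1) z (by omega)
    have hh := half_jumpExp_le hf hfm hs (e + d) (n + 1) z (by omega)
    rw [xi_eq_mul (by omega : n < n + (e + 1)), show e + 1 + d = e + d + 1 by omega,
      show n + (e + 1) = n + 1 + e by omega, mul_assoc]
    refine (mul_le_mul_of_nonneg_left i (by positivity)).trans ?_
    simp only [jumpExp, Finset.notMem_empty, if_false]
    set v0 := jumpExp f ∅ f (e + d) (n + 1) z
    set v1 := jumpExp f ∅ f (e + d) (n + 1) (z + 1)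
    have hn : (0 : ℝ) ≤ (n : ℝ)⁻¹ := by positivity
    have := mul_le_mul_of_nonneg_left hh hn
    have e1 : (1 + 1 / (2 * (n : ℝ))) * v0 = v0 + (n : ℝ)⁻¹ * (v0 / 2) := by
      rw [one_div, mul_inv]; ring
    have e2 : (1 - f z / n) * v0 + f z / n * v1 = v0 + (n : ℝ)⁻¹ * (f z * (v1 - v0)) := by ring
    rw [e1, e2]
    linarith

lemma jumpExp_mul_xi_le (hf : ∀ z, 0 < f z) (hfm : ∀ z, f z + 1 / 2 ≤ f (z + 1))
    (hs : ∀ z, f z ≤ z + s) (e d : ℕ) : ∀ n z, z + s ≤ n →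
      jumpExp f ∅ f d n z * xi (n + d) (n + d + e) ≤ jumpExp f ∅ f (d + e) n z := by
  induction d with
  | zero =>
    intro n z h
    have := xi_mul_jumpExp_le hf hfm hs 0 e n z h
    simp only [jumpExp, add_zero, zero_add] at this ⊢
    linarith
  | succ d ih =>
    intro n z h
    have i0 := ih (n + 1) z (by omega)
    have i1 := ih (n + 1) (z + 1) (by omega)
    have hp : 0 ≤ f z / n := div_nonneg (hf z).le (by positivity)
    have hq := sub_nonneg.2 (div_natCast_le_one hs h)
    rw [show d + 1 + e = d + e + 1 by omega, show n + (d + 1) = n + 1 + d by omega]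
    simp only [jumpExp, Finset.notMem_empty, if_false]
    linarith [mul_le_mul_of_nonneg_left i0 hq, mul_le_mul_of_nonneg_left i1 hp]

/-- Conditionally on the jumps at the times of `I`, the chain is dominated by a chain started in
a larger state. -/
lemma jumpExp_insert_le {ρ : ℕ → ℝ} (hf : ∀ z, 0 < f z) (hfm : ∀ z, f z + 1 / 2 ≤ f (z + 1))
    (hs : ∀ z, f z ≤ z + s) (hρ : ∀ z, 1 ≤ ρ z)
    (hρm : ∀ z, ρ (z + 1) ≤ ρ z) (ha : ∀ z, f (z + 1) * (ρ (z + 1) - 1) ≤ f z * (ρ z - 1))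
    (hfρ : ∀ z, f (z + 1) ≤ ρ z * f z) {J k l : ℕ}
    (hJ : ∀ z r, r ≤ k → f z * ρ z ^ r ≤ f (z + J)) (hl : l ∉ I) (e : ℕ) (d : ℕ) :
    ∀ n z r, n + d = l → z + J + r + s ≤ n → r ≤ k →
      (I.filter fun i => n ≤ i ∧ i < n + (d + 1 + e)).card ≤ r →
      jumpExp f (insert l I) 1 (d + 1 + e) n z
        ≤ jumpExp f I 1 (d + 1 + e) n z * (jumpExp f ∅ f d n (z + J + r) / l) := by
  have hfm' : ∀ z, f z ≤ f (z + 1) := fun z => by linarith [hfm z]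
  have hfM : Monotone f := monotone_nat_of_le_succ hfm'
  have hone : ∀ z : ℕ, (0 : ℝ) ≤ (1 : ℕ → ℝ) z := fun z => by simp
  have honem : ∀ z : ℕ, (1 : ℕ → ℝ) z ≤ (1 : ℕ → ℝ) (z + 1) := fun z => by simp
  have hrat := fun d n z r h1 h2 => jumpExp_succ_le (I := I) (g := 1) (t := 0) hf hs hone hρ hρm ha
    hfρ (by simp) d n z r h1 h2
  induction d with
  | zero =>
    intro n z r hnl h hr hc
    obtain rfl : n = l := by omega
    rw [show 0 + 1 + e = e + 1 by omega] at hc ⊢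
    rw [card_filter_Ico_succ, if_neg hl] at hc
    have hle := le_jumpExp_of_notMem (I := I) hf hfm' hs hone honem (d := e) (n := n) (z := z) hl
      (by omega)
    have hnn := jumpExp_nonneg (I := I) hf hs hone e (n + 1) z (by omega)
    have hra := hrat e (n + 1) z r (by omega) (by omega)
    have hp : 0 ≤ f z / n := div_nonneg (hf z).le (by positivity)
    have hcg := jumpExp_congr (f := f) (g := 1) (I := insert n I) (I' := I) e (n + 1) (z + 1)
      (fun i hi => by simp [show i ≠ n by omega])
    have lhs : jumpExp f (insert n I) 1 (e + 1) n z = f z / n * jumpExp f I 1 e (n + 1) (z + 1) := by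
      rw [← hcg]; simp [jumpExp]
    rw [lhs]
    have hJ' : f z * ρ z ^ r / n ≤ f (z + J + r) / n := by
      gcongr
      exact (hJ z r hr).trans (hfM (by omega))
    have hfJ : 0 ≤ f (z + J + r) / n := div_nonneg (hf _).le (by positivity)
    calc f z / n * jumpExp f I 1 e (n + 1) (z + 1)
        ≤ f z / n * (ρ z ^ r * jumpExp f I 1 e (n + 1) z) := by gcongr
      _ = jumpExp f I 1 e (n + 1) z * (f z * ρ z ^ r / n) := by ring
      _ ≤ jumpExp f I 1 e (n + 1) z * (f (z + J + r) / n) := by gcongr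
      _ ≤ jumpExp f I 1 (e + 1) n z * (f (z + J + r) / n) := by gcongr
  | succ d ih =>
    intro n z r hnl h hr hc
    rw [show d + 1 + 1 + e = d + 1 + e + 1 by omega] at hc ⊢
    rw [card_filter_Ico_succ] at hc
    have hp : 0 ≤ f z / n := div_nonneg (hf z).le (by positivity)
    have hq := sub_nonneg.2 (div_natCast_le_one hs (by omega : z + s ≤ n))
    have hnl' : n ≠ l := by omega
    by_cases hn : n ∈ I
    · rw [if_pos hn] at hc
      obtain ⟨r, rfl⟩ : ∃ r', r = r' + 1 := ⟨r - 1, by omega⟩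
      have i1 := ih (n + 1) (z + 1) r (by omega) (by omega) (by omega) (by omega)
      have hnn := jumpExp_nonneg (I := I) hf hs hone (d + 1 + e) (n + 1) (z + 1) (by omega)
      have hv := le_jumpExp_of_notMem (I := ∅) hf hfm' hs (fun z => (hf z).le) hfm' (d := d)
        (n := n) (z := z + J + (r + 1)) (by simp) (by omega)
      rw [show z + 1 + J + r = z + J + (r + 1) by omega] at i1
      have e1 : jumpExp f (insert l I) 1 (d + 1 + e + 1) n z
          = f z / n * jumpExp f (insert l I) 1 (d + 1 + e) (n + 1) (z + 1) := by
        rw [jumpExp, if_pos (Finset.mem_insert_of_mem hn)]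
      have e2 : jumpExp f I 1 (d + 1 + e + 1) n z
          = f z / n * jumpExp f I 1 (d + 1 + e) (n + 1) (z + 1) := by
        rw [jumpExp, if_pos hn]
      rw [e1, e2, mul_assoc]
      refine mul_le_mul_of_nonneg_left (i1.trans ?_) hp
      gcongr
    · rw [if_neg hn] at hc
      have i0 := ih (n + 1) z r (by omega) (by omega) (by omega) (by omega)
      have i1 := ih (n + 1) (z + 1) r (by omega) (by omega) (by omega) (by omega)
      have hnn := jumpExp_nonneg (I := I) hf hs hone (d + 1 + e) (n + 1) z (by omega)
      have hle := le_jumpExp_of_notMem (I := I) hf hfm' hs hone honem (d := d + 1 + e) (n := n)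
        (z := z) hn (by omega)
      have hra := hrat (d + 1 + e) (n + 1) z r (by omega) (by omega)
      have hv := jumpExp_mono (I := ∅) hf hfm' hs (fun z => (hf z).le) hfm' d (n + 1) (z + J + r)
        (by omega)
      have e1 : jumpExp f (insert l I) 1 (d + 1 + e + 1) n z
          = (1 - f z / n) * jumpExp f (insert l I) 1 (d + 1 + e) (n + 1) z
            + f z / n * jumpExp f (insert l I) 1 (d + 1 + e) (n + 1) (z + 1) := by
        rw [jumpExp, if_neg (by simp [hn, hnl'])]
      have e2 : jumpExp f I 1 (d + 1 + e + 1) n z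
          = (1 - f z / n) * jumpExp f I 1 (d + 1 + e) (n + 1) z
            + f z / n * jumpExp f I 1 (d + 1 + e) (n + 1) (z + 1) := by
        rw [jumpExp, if_neg hn]
      have e3 : jumpExp f ∅ f (d + 1) n (z + J + r)
          = jumpExp f ∅ f d (n + 1) (z + J + r) + f (z + J + r) / n *
            (jumpExp f ∅ f d (n + 1) (z + J + r + 1) - jumpExp f ∅ f d (n + 1) (z + J + r)) := by
        simp only [jumpExp, Finset.notMem_empty, if_false]; ring
      rw [show z + 1 + J + r = z + J + r + 1 by omega] at i1
      rw [e1, e3]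
      set H := jumpExp f I 1 (d + 1 + e + 1) n z
      set h0 := jumpExp f I 1 (d + 1 + e) (n + 1) z
      set h1 := jumpExp f I 1 (d + 1 + e) (n + 1) (z + 1)
      set u0 := jumpExp f ∅ f d (n + 1) (z + J + r)
      set u1 := jumpExp f ∅ f d (n + 1) (z + J + r + 1)
      have hu : 0 ≤ (u1 - u0) / l := div_nonneg (sub_nonneg.2 hv) (by positivity)
      have hJ' : f z * ρ z ^ r / n ≤ f (z + J + r) / n := by
        gcongr
        exact (hJ z r hr).trans (hfM (by omega))
      have hfJ : 0 ≤ f (z + J + r) / n := div_nonneg (hf _).le (by positivity)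
      have key : f z / n * h1 ≤ f (z + J + r) / n * H :=
        calc f z / n * h1 ≤ f z / n * (ρ z ^ r * h0) := by gcongr
          _ = f z * ρ z ^ r / n * h0 := by ring
          _ ≤ f (z + J + r) / n * H := by gcongr
      calc _ ≤ (1 - f z / n) * (h0 * (u0 / l)) + f z / n * (h1 * (u1 / l)) := by gcongr
        _ = H * (u0 / l) + f z / n * h1 * ((u1 - u0) / l) := by rw [e2]; ring
        _ ≤ H * (u0 / l) + f (z + J + r) / n * H * ((u1 - u0) / l) := by gcongr
        _ = _ := by ring

lemma jumpExp_add_le {ρ : ℕ → ℝ} (hf : ∀ z, 0 < f z) (hs : ∀ z, f z ≤ z + s)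
    (hρ : ∀ z, 1 ≤ ρ z) (hρm : ∀ z, ρ (z + 1) ≤ ρ z)
    (ha : ∀ z, f (z + 1) * (ρ (z + 1) - 1) ≤ f z * (ρ z - 1))
    (hfρ : ∀ z, f (z + 1) ≤ ρ z * f z) (d n z i : ℕ) (h : z + i + s ≤ n) :
    jumpExp f ∅ f d n (z + i) ≤ ρ 0 ^ i * jumpExp f ∅ f d n z := by
  induction i with
  | zero => simp
  | succ i ih =>
    have hi := ih (by omega)
    have h1 := jumpExp_succ_le (I := ∅) (g := f) (t := 1) hf hs (fun z => (hf z).le) hρ hρm ha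
      hfρ (by simpa using hfρ) d n (z + i) 1 (by omega) (by simp)
    have hn := jumpExp_nonneg (I := ∅) hf hs (fun z => (hf z).le) d n (z + i) (by omega)
    have h0 : ρ (z + i) ≤ ρ 0 := antitone_nat_of_succ_le hρm (Nat.zero_le _)
    have hρ0 : 0 ≤ ρ 0 := by linarith [hρ 0]
    rw [pow_one] at h1
    calc jumpExp f ∅ f d n (z + i + 1) ≤ ρ (z + i) * jumpExp f ∅ f d n (z + i) := h1
      _ ≤ ρ 0 * (ρ 0 ^ i * jumpExp f ∅ f d n z) := mul_le_mul h0 hi hn hρ0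
      _ = _ := by ring

/-- The conditional probability of a jump at time `l`, given jumps at the at most `k` times of `I`,
is at most of order `ψ^k(n₀, N) * ξ(m, N) * ξ(l, N) / N`. -/
lemma jumpExp_insert_le_mul {ρ : ℕ → ℝ} (hf : ∀ z, 0 < f z)
    (hfm : ∀ z, f z + 1 / 2 ≤ f (z + 1)) (hs : ∀ z, f z ≤ z + s) (hρ : ∀ z, 1 ≤ ρ z)
    (hρm : ∀ z, ρ (z + 1) ≤ ρ z) (ha : ∀ z, f (z + 1) * (ρ (z + 1) - 1) ≤ f z * (ρ z - 1))
    (hfρ : ∀ z, f (z + 1) ≤ ρ z * f z) {J k l n₀ m N : ℕ}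
    (hJ : ∀ z r, r ≤ k → f z * ρ z ^ r ≤ f (z + J)) (hl : l ∉ I) (hn₀ : J + k + s + 1 ≤ n₀)
    (hm : n₀ ≤ m) (hml : m ≤ l) (hlN : l < N) (hI : I.card ≤ k) :
    jumpExp f (insert l I) 1 (N - m) m 0 ≤ jumpExp f I 1 (N - m) m 0 *
      (ρ 0 ^ J * (jumpExp f ∅ f (N - n₀) n₀ k / xi n₀ N) / N * (xi m N * xi l N)) := by
  obtain ⟨d, rfl⟩ := Nat.exists_eq_add_of_le hml
  obtain ⟨e, rfl⟩ := Nat.exists_eq_add_of_le (Nat.succ_le_of_lt hlN)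
  obtain ⟨b, rfl⟩ := Nat.exists_eq_add_of_le hm
  rw [show n₀ + b + d + 1 + e - (n₀ + b) = d + 1 + e by omega,
    show n₀ + b + d + 1 + e - n₀ = b + (d + 1 + e) by omega]
  have h1 := jumpExp_insert_le hf hfm hs hρ hρm ha hfρ hJ hl e d (n₀ + b) 0 k rfl (by omega) le_rfl
    ((Finset.card_filter_le _ _).trans hI)
  have h2 := jumpExp_mul_xi_le hf hfm hs (1 + e) d (n₀ + b) (0 + J + k) (by omega)
  have h3 := xi_mul_jumpExp_le hf hfm hs (d + 1 + e) b n₀ (0 + J + k) (by omega)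
  have h4 := jumpExp_add_le hf hs hρ hρm ha hfρ (b + (d + 1 + e)) n₀ k J (by omega)
  have h5 := natCast_le_mul_xi_sq (l := n₀ + b + d) (N := n₀ + b + d + 1 + e) (by omega) (by omega)
  have hnn := jumpExp_nonneg (I := I) (g := 1) hf hs (fun z => by simp) (d + 1 + e) (n₀ + b) 0
    (by omega)
  rw [show k + J = 0 + J + k by omega] at h4
  rw [show n₀ + b + d + (1 + e) = n₀ + b + d + 1 + e by omega,
    show d + (1 + e) = d + 1 + e by omega] at h2
  refine h1.trans (mul_le_mul_of_nonneg_left ?_ hnn)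
  rw [← xi_mul_xi (l := n₀) (m := n₀ + b) (n := n₀ + b + d + 1 + e) (by omega) (by omega)]
  have hx := xi_pos n₀ (n₀ + b)
  have hw := xi_pos (n₀ + b) (n₀ + b + d + 1 + e)
  have hy := xi_pos (n₀ + b + d) (n₀ + b + d + 1 + e)
  have hl0 : (0 : ℝ) < ((n₀ + b + d : ℕ) : ℝ) := by exact_mod_cast (by omega : 0 < n₀ + b + d)
  have hN0 : (0 : ℝ) < ((n₀ + b + d + 1 + e : ℕ) : ℝ) := by
    exact_mod_cast (by omega : 0 < n₀ + b + d + 1 + e)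
  set x := xi n₀ (n₀ + b)
  set w := xi (n₀ + b) (n₀ + b + d + 1 + e)
  set y := xi (n₀ + b + d) (n₀ + b + d + 1 + e)
  set V := jumpExp f ∅ f d (n₀ + b) (0 + J + k)
  set E := jumpExp f ∅ f (b + (d + 1 + e)) n₀ k
  have hV : x * (V * y) ≤ ρ 0 ^ J * E := (mul_le_mul_of_nonneg_left h2 hx.le).trans (h3.trans h4)
  have hV0 : 0 ≤ V := jumpExp_nonneg hf hs (fun z => (hf z).le) _ _ _ (by omega)
  generalize ((n₀ + b + d : ℕ) : ℝ) = L at *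
  generalize ((n₀ + b + d + 1 + e : ℕ) : ℝ) = M at *
  have eq : ρ 0 ^ J * (E / (x * w)) / M * (w * y) = ρ 0 ^ J * E * y / (x * M) := by
    field_simp
  rw [eq, div_le_div_iff₀ hl0 (by positivity)]
  calc V * (x * M) ≤ V * (x * (L * y ^ 2)) := by gcongr
    _ = x * (V * y) * (y * L) := by ring
    _ ≤ ρ 0 ^ J * E * (y * L) := by gcongr
    _ = _ := by ring

end JumpExp

namespace DegreeEvolution

variable {Ω : Type} [MeasurableSpace Ω] {μ : Measure Ω} {f : ℕ → ℝ} {m k : ℕ} {Z : ℕ → Ω → ℕ}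

lemma le_add (hZ : DegreeEvolution μ f m k Z) (d : ℕ) (ω : Ω) : Z (m + d) ω ≤ k + d := by
  induction d with
  | zero => exact (hZ.init ω).le
  | succ d ih =>
    rcases hZ.incr (m + d) (by omega) ω with h | h <;> rw [← add_assoc, h] <;> omega

lemma measurableSet_jump (hZ : DegreeEvolution μ f m k Z) (n : ℕ) :
    MeasurableSet {ω | Z (n + 1) ω = Z n ω + 1} :=
  measurableSet_eq_fun (hZ.measurable _) ((hZ.measurable _).add_const 1)

lemma measurableSet_history (hZ : DegreeEvolution μ f m k Z) (n : ℕ) (h : ℕ → ℕ) :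
    MeasurableSet {ω | ∀ i, m ≤ i → i ≤ n → Z i ω = h i} := by
  simp only [Set.ofPred_forall]
  exact MeasurableSet.iInter fun i => MeasurableSet.iInter fun _ => MeasurableSet.iInter fun _ =>
    measurableSet_eq_fun (hZ.measurable i) measurable_const

lemma measurableSet_jumps (hZ : DegreeEvolution μ f m k Z) (I : Finset ℕ) (p : ℕ → Prop) :
    MeasurableSet {ω | ∀ i ∈ I, p i → Z (i + 1) ω = Z i ω + 1} := by
  simp only [Set.ofPred_forall]
  exact MeasurableSet.iInter fun i => MeasurableSet.iInter fun _ => MeasurableSet.iInter fun _ =>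
    hZ.measurableSet_jump i

lemma integrable_indicator_jumps [IsProbabilityMeasure μ] (hZ : DegreeEvolution μ f m k Z)
    (I : Finset ℕ) (p : ℕ → Prop) (g : ℕ → ℝ) (d : ℕ) :
    Integrable ({ω | ∀ i ∈ I, p i → Z (i + 1) ω = Z i ω + 1}.indicator
      fun ω => g (Z (m + d) ω)) μ := by
  refine Integrable.indicator ?_ (hZ.measurableSet_jumps I p)
  refine Integrable.of_bound (C := ∑ i ∈ Finset.range (k + d + 1), |g i|)
    ((measurable_from_top.comp (hZ.measurable _)).aestronglyMeasurable) (ae_of_all _ fun ω => ?_)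
  exact Finset.single_le_sum (f := fun i => |g i|) (fun i _ => abs_nonneg _)
    (Finset.mem_range.2 (Nat.lt_succ_of_le (hZ.le_add d ω)))

lemma setIntegral_history [IsProbabilityMeasure μ] (hZ : DegreeEvolution μ f m k Z)
    (hf : ∀ z, 0 < f z) (I : Finset ℕ) (g : ℕ → ℝ) (d : ℕ) : ∀ n, m ≤ n → ∀ h : ℕ → ℕ,
    ∫ ω in {ω | ∀ i, m ≤ i → i ≤ n → Z i ω = h i},
        {ω | ∀ i ∈ I, n ≤ i ∧ i < n + d → Z (i + 1) ω = Z i ω + 1}.indicator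
          (fun ω => g (Z (n + d) ω)) ω ∂μ
      = μ.real {ω | ∀ i, m ≤ i → i ≤ n → Z i ω = h i} * jumpExp f I g d n (h n) := by
  induction d with
  | zero =>
    intro n hn h
    rw [setIntegral_congr_fun (g := fun _ => g (h n)) (hZ.measurableSet_history n h)]
    · simp [jumpExp]
    · intro ω hω
      have e : {ω | ∀ i ∈ I, n ≤ i ∧ i < n + 0 → Z (i + 1) ω = Z i ω + 1} = Set.univ := by
        ext ω'
        simp only [Set.mem_ofPred_eq, Set.mem_univ, iff_true]
        intro i _ hi
        omega
      rw [e]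
      simp only [Set.indicator_univ, add_zero, hω n hn le_rfl]
  | succ d ih =>
    intro n hn h
    set C : Set Ω := {ω | ∀ i, m ≤ i → i ≤ n → Z i ω = h i} with hC
    set h₀ : ℕ → ℕ := Function.update h (n + 1) (h n) with hh₀
    set h₁ : ℕ → ℕ := Function.update h (n + 1) (h n + 1) with hh₁
    set C₀ : Set Ω := {ω | ∀ i, m ≤ i → i ≤ n + 1 → Z i ω = h₀ i} with hC₀
    set C₁ : Set Ω := {ω | ∀ i, m ≤ i → i ≤ n + 1 → Z i ω = h₁ i} with hC₁
    have mem_upd : ∀ (v : ℕ) (ω : Ω),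
        (∀ i, m ≤ i → i ≤ n + 1 → Z i ω = Function.update h (n + 1) v i)
          ↔ ω ∈ C ∧ Z (n + 1) ω = v := by
      intro v ω
      constructor
      · intro H
        refine ⟨fun i hi hin => ?_, ?_⟩
        · rw [H i hi (by omega), Function.update_of_ne (by omega)]
        · rw [H (n + 1) (by omega) le_rfl, Function.update_self]
      · rintro ⟨H, Hv⟩ i hi hin
        rcases eq_or_ne i (n + 1) with rfl | hne
        · rw [Hv, Function.update_self]
        · rw [H i hi (by omega), Function.update_of_ne hne]
    have m₀ : ∀ ω, ω ∈ C₀ ↔ ω ∈ C ∧ Z (n + 1) ω = h n := mem_upd _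
    have m₁ : ∀ ω, ω ∈ C₁ ↔ ω ∈ C ∧ Z (n + 1) ω = h n + 1 := mem_upd _
    have hZn : ∀ ω ∈ C, Z n ω = h n := fun ω hω => hω n hn le_rfl
    have hCU : C = C₀ ∪ C₁ := by
      ext ω
      rw [Set.mem_union, m₀, m₁]
      constructor
      · intro hω
        rcases hZ.incr n hn ω with hi | hi <;> rw [hZn ω hω] at hi
        · exact Or.inl ⟨hω, hi⟩
        · exact Or.inr ⟨hω, hi⟩
      · rintro (H | H) <;> exact H.1
    have hdisj : Disjoint C₀ C₁ := by
      rw [Set.disjoint_left]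
      intro ω h0 h1
      have a := ((m₀ ω).1 h0).2
      have b := ((m₁ ω).1 h1).2
      omega
    have hM₁ : MeasurableSet C₁ := hZ.measurableSet_history _ _
    have hM₀ : MeasurableSet C₀ := hZ.measurableSet_history _ _
    have hp : 0 ≤ f (h n) / n := div_nonneg (hf _).le (by positivity)
    have hμ₁ : μ.real C₁ = f (h n) / n * μ.real C := by
      have e : C₁ = {ω | Z (n + 1) ω = Z n ω + 1} ∩ C := by
        ext ω
        rw [m₁, Set.mem_inter_iff, and_comm]
        refine and_congr_left fun hω => ?_
        rw [Set.mem_ofPred_eq, hZn ω hω]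
      rw [Measure.real, e, hZ.jump n hn h, ENNReal.toReal_mul, ENNReal.toReal_ofReal hp]
      rfl
    have hμ₀ : μ.real C₀ = (1 - f (h n) / n) * μ.real C := by
      have e := measureReal_union (μ := μ) hdisj hM₁
      rw [← hCU, hμ₁] at e
      linarith
    have hint := hZ.integrable_indicator_jumps I (fun i => n ≤ i ∧ i < n + (d + 1)) g
      (n + (d + 1) - m)
    rw [show m + (n + (d + 1) - m) = n + (d + 1) by omega] at hint
    have ih₁ := ih (n + 1) (by omega) h₁
    have ih₀ := ih (n + 1) (by omega) h₀
    rw [show n + 1 + d = n + (d + 1) by omega] at ih₀ ih₁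
    rw [show h₁ (n + 1) = h n + 1 from Function.update_self .., ← hC₁, hμ₁] at ih₁
    rw [show h₀ (n + 1) = h n from Function.update_self .., ← hC₀, hμ₀] at ih₀
    have red₁ : ∫ ω in C₁, {ω | ∀ i ∈ I, n ≤ i ∧ i < n + (d + 1) →
          Z (i + 1) ω = Z i ω + 1}.indicator (fun ω => g (Z (n + (d + 1)) ω)) ω ∂μ
        = f (h n) / n * μ.real C * jumpExp f I g d (n + 1) (h n + 1) := by
      rw [← ih₁]
      refine setIntegral_congr_fun hM₁ fun ω hω => ?_
      refine Set.indicator_eq_indicator ?_ rfl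
      simp only [Set.mem_ofPred_eq]
      constructor
      · exact fun H i hi hin => H i hi ⟨by omega, hin.2⟩
      · intro H i hi hin
        rcases eq_or_lt_of_le hin.1 with rfl | hlt
        · rw [((m₁ ω).1 hω).2, hZn ω ((m₁ ω).1 hω).1]
        · exact H i hi ⟨by omega, hin.2⟩
    rw [hCU, setIntegral_union hdisj hM₁ hint.integrableOn hint.integrableOn, ← hCU, red₁]
    by_cases hnI : n ∈ I
    · have red₀ : ∫ ω in C₀, {ω | ∀ i ∈ I, n ≤ i ∧ i < n + (d + 1) →
          Z (i + 1) ω = Z i ω + 1}.indicator (fun ω => g (Z (n + (d + 1)) ω)) ω ∂μ = 0 := by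
        refine setIntegral_eq_zero_of_forall_eq_zero fun ω hω => ?_
        refine Set.indicator_of_notMem (fun H => ?_) _
        have a := H n hnI ⟨le_rfl, by omega⟩
        rw [((m₀ ω).1 hω).2, hZn ω ((m₀ ω).1 hω).1] at a
        omega
      rw [red₀, jumpExp, if_pos hnI]
      ring
    · have red₀ : ∫ ω in C₀, {ω | ∀ i ∈ I, n ≤ i ∧ i < n + (d + 1) →
          Z (i + 1) ω = Z i ω + 1}.indicator (fun ω => g (Z (n + (d + 1)) ω)) ω ∂μ
          = (1 - f (h n) / n) * μ.real C * jumpExp f I g d (n + 1) (h n) := by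
        rw [← ih₀]
        refine setIntegral_congr_fun hM₀ fun ω hω => ?_
        refine Set.indicator_eq_indicator ?_ rfl
        simp only [Set.mem_ofPred_eq]
        refine forall₂_congr fun i hi => ?_
        have : i ≠ n := by rintro rfl; exact hnI hi
        rw [show (n ≤ i ∧ i < n + (d + 1)) ↔ (n + 1 ≤ i ∧ i < n + (d + 1)) by omega]
      rw [red₀, jumpExp, if_neg hnI]
      ring

lemma integral_indicator_jumps [IsProbabilityMeasure μ] (hZ : DegreeEvolution μ f m k Z)
    (hf : ∀ z, 0 < f z) (I : Finset ℕ) (g : ℕ → ℝ) (d : ℕ) :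
    ∫ ω, {ω | ∀ i ∈ I, m ≤ i ∧ i < m + d → Z (i + 1) ω = Z i ω + 1}.indicator
      (fun ω => g (Z (m + d) ω)) ω ∂μ = jumpExp f I g d m k := by
  have h := hZ.setIntegral_history hf I g d m le_rfl fun _ => k
  have e : {ω | ∀ i, m ≤ i → i ≤ m → Z i ω = k} = Set.univ := by
    ext ω
    simp only [Set.mem_ofPred_eq, Set.mem_univ, iff_true]
    intro i h1 h2
    rw [le_antisymm h2 h1, hZ.init]
  simpa [e] using h

lemma integral_eq_jumpExp [IsProbabilityMeasure μ] (hZ : DegreeEvolution μ f m k Z)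
    (hf : ∀ z, 0 < f z) (g : ℕ → ℝ) (d : ℕ) :
    ∫ ω, g (Z (m + d) ω) ∂μ = jumpExp f ∅ g d m k := by
  simpa using hZ.integral_indicator_jumps hf ∅ g d

lemma measureReal_jumps_eq_jumpExp [IsProbabilityMeasure μ] (hZ : DegreeEvolution μ f m k Z)
    (hf : ∀ z, 0 < f z) {I : Finset ℕ} {d : ℕ} (hI : I ⊆ Finset.Ico m (m + d)) :
    μ.real {ω | ∀ i ∈ I, Z (i + 1) ω = Z i ω + 1} = jumpExp f I 1 d m k := by
  have h := hZ.integral_indicator_jumps hf I 1 d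
  have e : {ω | ∀ i ∈ I, m ≤ i ∧ i < m + d → Z (i + 1) ω = Z i ω + 1}
      = {ω | ∀ i ∈ I, Z (i + 1) ω = Z i ω + 1} := by
    ext ω
    exact forall₂_congr fun i hi => ⟨fun H => H (Finset.mem_Ico.1 (hI hi)), fun H _ => H⟩
  have hM := hZ.measurableSet_jumps I fun i => m ≤ i ∧ i < m + d
  rw [e] at h hM
  rw [← h, ← integral_indicator_one hM]
  rfl

end DegreeEvolution

lemma exists_jump_ratio_bounds {α β : ℝ} (hα : 0 ≤ α) (hβ : 0 < β) (k : ℕ) :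
    ∃ (ρ : ℕ → ℝ) (J : ℕ), (∀ z, 1 ≤ ρ z) ∧ (∀ z, ρ (z + 1) ≤ ρ z) ∧
      (∀ z, fPA α β (z + 1) * (ρ (z + 1) - 1) ≤ fPA α β z * (ρ z - 1)) ∧
      (∀ z, fPA α β (z + 1) ≤ ρ z * fPA α β z) ∧
      ∀ z r, r ≤ k → fPA α β z * ρ z ^ r ≤ fPA α β (z + J) := by
  obtain ⟨c, hc, hcβ⟩ : ∃ c : ℝ, 0 < c ∧ (1 + α) / 2 * c = β :=
    ⟨2 * β / (1 + α), by positivity, by field_simp⟩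
  have hf := fPA_pos hα hβ
  have key := fPA_succ_mul_le hα hc hcβ
  set ρ : ℕ → ℝ := fun z => 1 + 1 / (z + c) with hρdef
  have hρ : ∀ z, 1 ≤ ρ z := fun z => by
    have : 0 ≤ 1 / ((z : ℝ) + c) := by positivity
    simp only [hρdef]; linarith
  have hρm : ∀ z, ρ (z + 1) ≤ ρ z := fun z => by
    simp only [hρdef]
    push_cast
    gcongr
    linarith
  have ha : ∀ z, fPA α β (z + 1) * (ρ (z + 1) - 1) ≤ fPA α β z * (ρ z - 1) := fun z => by
    simp only [hρdef, add_sub_cancel_left, mul_one_div]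
    push_cast
    rw [div_le_div_iff₀ (by positivity) (by positivity)]
    exact key z
  have hfρ : ∀ z, fPA α β (z + 1) ≤ ρ z * fPA α β z := fun z => by
    have hz : (0 : ℝ) < z + c := by positivity
    have e : ρ z * fPA α β z = fPA α β z * (z + 1 + c) / (z + c) := by
      simp only [hρdef]; field_simp; ring
    rw [e, le_div_iff₀ hz]
    exact key z
  obtain ⟨J, hJ⟩ := exists_nat_ge (2 * (fPA α β 0 * (ρ 0 ^ k - 1)))
  refine ⟨ρ, J, hρ, hρm, ha, hfρ, fun z r hr => ?_⟩
  have h1 : fPA α β z * (ρ z ^ r - 1) ≤ fPA α β 0 * (ρ 0 ^ r - 1) :=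
    antitone_nat_of_succ_le (f := fun z => fPA α β z * (ρ z ^ r - 1))
      (mul_pow_sub_one_succ_le hf hρ hρm ha r) (Nat.zero_le z)
  have h2 : fPA α β 0 * (ρ 0 ^ r - 1) ≤ fPA α β 0 * (ρ 0 ^ k - 1) := by
    have := pow_le_pow_right₀ (hρ 0) hr
    have := (hf 0).le
    gcongr
  have h3 : ∀ i : ℕ, fPA α β z + i / 2 ≤ fPA α β (z + i) := by
    intro i
    induction i with
    | zero => simp
    | succ i ih =>
      have := fPA_succ hα (β := β) (z + i)
      push_cast
      rw [← add_assoc]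
      linarith
  linarith [h3 J]

theorem stmt12 (α β : ℝ) (hα : 0 ≤ α) (hβ : 0 < β) (k : ℕ) (hk : 1 ≤ k) :
    ∃ n₀ : ℕ, 1 ≤ n₀ ∧ ∃ C : ℝ, 0 < C ∧
      ∀ (Ω : Type) (_ : MeasurableSpace Ω) (μ : Measure Ω), IsProbabilityMeasure μ →
      ∀ (Ω' : Type) (_ : MeasurableSpace Ω') (μ' : Measure Ω'), IsProbabilityMeasure μ' →
      ∀ m N : ℕ, n₀ ≤ m → m ≤ N →
      ∀ Z : ℕ → Ω → ℕ, DegreeEvolution μ (fPA α β) m 0 Z →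
      -- a reference degree evolution started at `k` at time `n₀`, used to express `ψ^k(n₀,N)`
      ∀ Z' : ℕ → Ω' → ℕ, DegreeEvolution μ' (fPA α β) n₀ k Z' →
      ∀ I₀ I₁ : Finset ℕ, I₀ ⊆ Finset.Ico m N → I₁ ⊆ Finset.Ico m N → Disjoint I₀ I₁ →
      I₁.card + 1 ≤ k →
      xi m N * (∑ l ∈ I₀, xi l N)
          ≤ C * (N : ℝ) / (2 * ((∫ ω, fPA α β (Z' N ω) ∂μ') / xi n₀ N)) →
      0 < μ ({ω | ∀ l ∈ I₀, Z (l + 1) ω = Z l ω} ∩ {ω | ∀ l ∈ I₁, Z (l + 1) ω = Z l ω + 1}) →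
      ∀ j : ℕ, m ≤ j → j < N → j ∉ I₀ →
        2⁻¹ * (μ ({ω | Z (j + 1) ω = Z j ω + 1} ∩ {ω | ∀ l ∈ I₁, Z (l + 1) ω = Z l ω + 1})
            / μ {ω | ∀ l ∈ I₁, Z (l + 1) ω = Z l ω + 1})
          ≤ μ ({ω | Z (j + 1) ω = Z j ω + 1}
                ∩ ({ω | ∀ l ∈ I₀, Z (l + 1) ω = Z l ω} ∩ {ω | ∀ l ∈ I₁, Z (l + 1) ω = Z l ω + 1}))
            / μ ({ω | ∀ l ∈ I₀, Z (l + 1) ω = Z l ω} ∩ {ω | ∀ l ∈ I₁, Z (l + 1) ω = Z l ω + 1}) := by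
  have hf := fPA_pos hα hβ
  have hfm := fPA_succ hα (β := β)
  obtain ⟨s, hs⟩ := exists_fPA_le_add (β := β) hα
  obtain ⟨ρ, J, hρ, hρm, ha, hfρ, hJ⟩ := exists_jump_ratio_bounds hα hβ k
  have hP : 0 < ρ 0 ^ J := pow_pos (by linarith [hρ 0]) _
  refine ⟨J + k + s + 1, by omega, (ρ 0 ^ J)⁻¹, inv_pos.2 hP, ?_⟩
  intro Ω _ μ _ Ω' _ μ' _ m N hm hmN Z hZ Z' hZ' I₀ I₁ hI₀ hI₁ hdisj hcard hsum hpos j hmj hjN hj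
  set n₀ := J + k + s + 1 with hn₀
  set I := insert j I₁ with hIdef
  have hIcard : I.card ≤ k := (Finset.card_insert_le _ _).trans hcard
  have hIsub : I ⊆ Finset.Ico m N :=
    Finset.insert_subset (Finset.mem_Ico.2 ⟨hmj, hjN⟩) hI₁
  have hE := hZ'.integral_eq_jumpExp hf (fPA α β) (N - n₀)
  rw [show n₀ + (N - n₀) = N by omega] at hE
  have hEpos : 0 < jumpExp (fPA α β) ∅ (fPA α β) (N - n₀) n₀ k := by
    have h := xi_mul_jumpExp_le hf hfm hs 0 (N - n₀) n₀ k (by omega)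
    exact (mul_pos (xi_pos _ _) (hf k)).trans_le h
  have hprob : ∀ {I' : Finset ℕ}, I' ⊆ Finset.Ico m N →
      μ.real {ω | ∀ i ∈ I', Z (i + 1) ω = Z i ω + 1}
        = jumpExp (fPA α β) I' 1 (N - m) m 0 := fun hI' =>
    hZ.measureReal_jumps_eq_jumpExp hf (by rwa [show m + (N - m) = N by omega])
  rw [hE] at hsum
  have hψ : 0 < jumpExp (fPA α β) ∅ (fPA α β) (N - n₀) n₀ k / xi n₀ N :=
    div_pos hEpos (xi_pos _ _)
  set ψ := jumpExp (fPA α β) ∅ (fPA α β) (N - n₀) n₀ k / xi n₀ N with hψdef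
  have hN0 : (0 : ℝ) < N := by exact_mod_cast (by omega : 0 < N)
  set D := {ω | ∀ i ∈ I, Z (i + 1) ω = Z i ω + 1} with hD
  have hterm : ∀ l ∈ I₀, μ.real {ω | ∀ i ∈ insert l I, Z (i + 1) ω = Z i ω + 1}
      ≤ μ.real D * (ρ 0 ^ J * ψ / N * (xi m N * xi l N)) := by
    intro l hl
    have hlm := Finset.mem_Ico.1 (hI₀ hl)
    have hlI : l ∉ I := by
      rw [hIdef, Finset.mem_insert, not_or]
      exact ⟨fun h => hj (h ▸ hl), Finset.disjoint_left.1 hdisj hl⟩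
    rw [hprob (Finset.insert_subset (hI₀ hl) hIsub), hD, hprob hIsub]
    exact jumpExp_insert_le_mul hf hfm hs hρ hρm ha hfρ hJ hlI le_rfl hm hlm.1 hlm.2 hIcard
  have hsum' : ∑ l ∈ I₀, μ.real {ω | ∀ i ∈ insert l I, Z (i + 1) ω = Z i ω + 1}
      ≤ μ.real D / 2 := by
    refine (Finset.sum_le_sum hterm).trans ?_
    rw [← Finset.mul_sum, ← Finset.mul_sum, ← Finset.mul_sum, div_eq_mul_one_div (μ.real D)]
    refine mul_le_mul_of_nonneg_left ?_ measureReal_nonneg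
    calc ρ 0 ^ J * ψ / N * (xi m N * ∑ l ∈ I₀, xi l N)
        ≤ ρ 0 ^ J * ψ / N * ((ρ 0 ^ J)⁻¹ * N / (2 * ψ)) := by gcongr
      _ = 1 / 2 := by field_simp
  set A₀ := {ω | ∀ l ∈ I₀, Z (l + 1) ω = Z l ω}
  set A₁ := {ω | ∀ l ∈ I₁, Z (l + 1) ω = Z l ω + 1}
  set B := {ω | Z (j + 1) ω = Z j ω + 1}
  have hBD : B ∩ A₁ = D := by
    ext ω
    simp [B, A₁, hD, hIdef]
  have hcover : D ⊆ (B ∩ (A₀ ∩ A₁)) ∪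
      ⋃ l ∈ I₀, {ω | ∀ i ∈ insert l I, Z (i + 1) ω = Z i ω + 1} := by
    intro ω hω
    by_cases h : ω ∈ A₀
    · rw [← hBD] at hω
      exact Or.inl ⟨hω.1, h, hω.2⟩
    · refine Or.inr ?_
      obtain ⟨l, hl, hne⟩ : ∃ l ∈ I₀, Z (l + 1) ω ≠ Z l ω := by
        simpa [A₀] using h
      simp only [Set.mem_iUnion]
      refine ⟨l, hl, fun i hi => ?_⟩
      rcases Finset.mem_insert.1 hi with rfl | hi
      · exact (hZ.incr i (Finset.mem_Ico.1 (hI₀ hl)).1 ω).resolve_left hne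
      · exact hω i hi
  have hreal : μ.real D / 2 ≤ μ.real (B ∩ (A₀ ∩ A₁)) := by
    have h := (measureReal_mono (μ := μ) hcover).trans
      ((measureReal_union_le _ _).trans (add_le_add_right (measureReal_biUnion_finset_le _ _) _))
    linarith
  have hhalf : 2⁻¹ * μ (B ∩ A₁) ≤ μ (B ∩ (A₀ ∩ A₁)) := by
    rw [hBD, ← ENNReal.toReal_le_toReal (by finiteness) (by finiteness), ENNReal.toReal_mul,
      ENNReal.toReal_inv, ENNReal.toReal_ofNat]
    have : μ.real D / 2 = 2⁻¹ * (μ D).toReal := by rw [Measure.real]; ring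
    rw [← this]
    exact hreal
  rw [← mul_div_assoc]
  exact ENNReal.div_le_div hhalf (measure_mono Set.inter_subset_right)
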